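/- Define q̃(β) = I₁(β)/(2 I₀(β)) for β ∈ ℝ. Then lim_{β→+∞} [ 2β q̃(β) − ln I₀(β) + (1/2) ln(1/4 − q̃(β)²) ] = −(1 − ln(π/2))/2. (The two-dimensional entropy correction term ΔS̃ has the limit −(1 − ln(π/2))/2 at the boundary value q̃ = 1/2; this is Theorem 3.2(ii).) -/

import Mathlib

open Real Filter

/-- The modified Bessel function of integer order `n`:
`Iₙ(μ) = (1/(2π)) ∫₀^{2π} e^{μ cos θ} cos (n θ) dθ`. -/
noncomputable def besselI (n : ℤ) (μ : ℝ) : ℝ :=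
  (1 / (2 * Real.pi)) * ∫ θ in (0:ℝ)..(2 * Real.pi),
    Real.exp (μ * Real.cos θ) * Real.cos ((n : ℝ) * θ)

/-- `q̃(β) = I₁(β)/(2 I₀(β))`. -/
noncomputable def qTilde (β : ℝ) : ℝ := besselI 1 β / (2 * besselI 0 β)

open MeasureTheory Topology in
lemma laplace_aux (g : ℝ → ℝ) (hg : Continuous g)
    (hb : ∀ u, 0 ≤ u → |g u| ≤ 2 * Real.exp (-u / 2)) :
    Tendsto (fun β : ℝ => Real.sqrt β * ∫ θ in (0:ℝ)..(2 * Real.pi), g (β * (1 - Real.cos θ)))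
      atTop (𝓝 (∫ t : ℝ, g (t ^ 2 / 2))) := by
  have hpi := Real.pi_pos
  have key : ∀ᶠ β : ℝ in atTop,
      (∫ t : ℝ, (Set.Ioc (-(Real.pi * Real.sqrt β)) (Real.pi * Real.sqrt β)).indicator
        (fun t => g (β * (1 - Real.cos (t / Real.sqrt β)))) t)
      = Real.sqrt β * ∫ θ in (0:ℝ)..(2 * Real.pi), g (β * (1 - Real.cos θ)) := by
    filter_upwards [eventually_gt_atTop 0] with β hβ
    have hs : 0 < Real.sqrt β := Real.sqrt_pos.2 hβ
    rw [integral_indicator measurableSet_Ioc,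
      ← intervalIntegral.integral_of_le (by nlinarith [mul_pos hpi hs])]
    have h1 := intervalIntegral.integral_comp_div (a := -(Real.pi * Real.sqrt β))
      (b := Real.pi * Real.sqrt β) (fun θ => g (β * (1 - Real.cos θ))) hs.ne'
    rw [h1, smul_eq_mul]
    have hper : Function.Periodic (fun θ => g (β * (1 - Real.cos θ))) (2 * Real.pi) := by
      intro x
      simp [Real.cos_add_two_pi]
    have h2 := hper.intervalIntegral_add_eq (-Real.pi) 0
    rw [zero_add] at h2
    rw [← h2]
    congr 2
    · field_simp
    · field_simp
      ring
  refine Tendsto.congr' key ?_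
  refine tendsto_integral_filter_of_dominated_convergence
    (fun t => 2 * Real.exp (-(1 / Real.pi ^ 2) * t ^ 2)) ?_ ?_ ?_ ?_
  · refine Eventually.of_forall fun β => ?_
    refine (Measurable.indicator ?_ measurableSet_Ioc).aestronglyMeasurable
    exact (by fun_prop : Continuous fun t => g (β * (1 - Real.cos (t / Real.sqrt β)))).measurable
  · filter_upwards [eventually_gt_atTop 0] with β hβ
    have hs : 0 < Real.sqrt β := Real.sqrt_pos.2 hβ
    refine Eventually.of_forall fun t => ?_
    by_cases ht : t ∈ Set.Ioc (-(Real.pi * Real.sqrt β)) (Real.pi * Real.sqrt β)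
    · rw [Set.indicator_of_mem ht, Real.norm_eq_abs]
      have hx : |t / Real.sqrt β| ≤ Real.pi := by
        rw [abs_div, abs_of_pos hs, div_le_iff₀ hs, abs_le]
        exact ⟨ht.1.le, ht.2⟩
      have hc := Real.cos_le_one_sub_mul_cos_sq hx
      refine (hb _ (mul_nonneg hβ.le (by linarith [Real.cos_le_one (t / Real.sqrt β)]))).trans ?_
      gcongr
      have h3 : 2 / Real.pi ^ 2 * (t / Real.sqrt β) ^ 2 ≤ 1 - Real.cos (t / Real.sqrt β) := by
        linarith
      have h4 := mul_le_mul_of_nonneg_left h3 hβ.le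
      have h5 : β * (2 / Real.pi ^ 2 * (t / Real.sqrt β) ^ 2) = 2 * (1 / Real.pi ^ 2 * t ^ 2) := by
        rw [div_pow, Real.sq_sqrt hβ.le]
        field_simp
      linarith
    · rw [Set.indicator_of_notMem ht, norm_zero]
      positivity
  · exact (integrable_exp_neg_mul_sq (by positivity)).const_mul 2
  · refine Eventually.of_forall fun t => ?_
    have hsq : Tendsto Real.sqrt atTop atTop := Real.tendsto_sqrt_atTop
    have hmem : ∀ᶠ β : ℝ in atTop,
        t ∈ Set.Ioc (-(Real.pi * Real.sqrt β)) (Real.pi * Real.sqrt β) := by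
      have := hsq.const_mul_atTop hpi
      filter_upwards [this.eventually_gt_atTop |t|] with β hβ
      exact ⟨(abs_lt.1 hβ).1, (abs_lt.1 hβ).2.le⟩
    have hlim : Tendsto (fun β : ℝ => t ^ 2 / 2 * Real.sinc (t / 2 / Real.sqrt β) ^ 2) atTop
        (𝓝 (t ^ 2 / 2)) := by
      have h0 : Tendsto (fun β : ℝ => t / 2 / Real.sqrt β) atTop (𝓝 0) :=
        hsq.const_div_atTop _
      have h1 := (Real.continuous_sinc.tendsto 0).comp h0
      rw [Real.sinc_zero] at h1
      simpa using (h1.pow 2).const_mul (t ^ 2 / 2)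
    refine Tendsto.congr' ?_ ((hg.tendsto _).comp hlim)
    filter_upwards [hmem, eventually_gt_atTop 0] with β hβ hβ0
    have hs : 0 < Real.sqrt β := Real.sqrt_pos.2 hβ0
    rw [Set.indicator_of_mem hβ]
    simp only [Function.comp]
    congr 1
    by_cases ht : t = 0
    · simp [ht]
    rw [Real.sinc_of_ne_zero (by positivity), div_pow, div_pow, Real.sq_sqrt hβ0.le]
    have : Real.cos (t / Real.sqrt β) = 1 - 2 * Real.sin (t / 2 / Real.sqrt β) ^ 2 := by
      have e : t / Real.sqrt β = 2 * (t / 2 / Real.sqrt β) := by ring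
      rw [e, Real.cos_two_mul, Real.cos_sq']
      ring
    rw [this]
    field_simp
    try ring

open MeasureTheory in
lemma gauss0 : ∫ t : ℝ, Real.exp (-(t ^ 2 / 2)) = Real.sqrt (2 * Real.pi) := by
  have h := integral_gaussian (1 / 2)
  rw [show Real.pi / (1 / 2) = 2 * Real.pi by ring] at h
  rw [← h]
  congr 1
  ext t
  ring_nf

open MeasureTheory in
lemma gauss2 : ∫ t : ℝ, (t ^ 2 / 2) * Real.exp (-(t ^ 2 / 2)) = Real.sqrt (2 * Real.pi) / 2 := by
  have i0 : Integrable fun t : ℝ => Real.exp (-(t ^ 2 / 2)) := by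
    have := integrable_exp_neg_mul_sq (b := 1 / 2) (by norm_num)
    refine this.congr (Eventually.of_forall fun t => ?_)
    simp only
    ring_nf
  have i1 : Integrable fun t : ℝ => t * Real.exp (-(t ^ 2 / 2)) := by
    have := integrable_mul_exp_neg_mul_sq (b := 1 / 2) (by norm_num)
    refine this.congr (Eventually.of_forall fun t => ?_)
    simp only
    ring_nf
  have i2 : Integrable fun t : ℝ => t ^ 2 / 2 * Real.exp (-(t ^ 2 / 2)) := by
    have := (integrable_rpow_mul_exp_neg_mul_sq (b := 1 / 2) (by norm_num) (s := 2)
      (by norm_num)).const_mul (1 / 2)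
    refine this.congr (Eventually.of_forall fun t => ?_)
    simp only [Real.rpow_two]
    ring_nf
  have hz := integral_eq_zero_of_hasDerivAt_of_integrable
    (f := fun t : ℝ => t * Real.exp (-(t ^ 2 / 2)))
    (f' := fun t : ℝ => Real.exp (-(t ^ 2 / 2)) - 2 * (t ^ 2 / 2 * Real.exp (-(t ^ 2 / 2))))
    (fun t => by
      have h1 : HasDerivAt (fun t : ℝ => -(t ^ 2 / 2)) (-t) t := by
        have := ((hasDerivAt_pow 2 t).div_const 2).neg
        exact this.congr_deriv (by norm_num)
      exact ((hasDerivAt_id t).mul h1.exp).congr_deriv (by simp only [id]; ring))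
    (i0.sub (i2.const_mul 2)) i1
  rw [integral_sub i0 (i2.const_mul 2), integral_const_mul, gauss0] at hz
  linarith

/-- The 2D entropy correction term `ΔS̃`, expressed in `β`, has the limit
`−(1 − ln(π/2))/2` as `β → +∞` (i.e. at the boundary value `q̃ = 1/2`);
this is Theorem 3.2(ii). -/
theorem correction_2d_boundary_limit :
    Tendsto (fun β : ℝ =>
        2 * β * qTilde β - Real.log (besselI 0 β)
          + (1/2) * Real.log (1/4 - qTilde β ^ 2))
      atTop (nhds (-(1 - Real.log (Real.pi / 2)) / 2)) := by
  have hpi := Real.pi_pos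
  set A : ℝ → ℝ := fun β => ∫ θ in (0:ℝ)..(2 * Real.pi), Real.exp (-(β * (1 - Real.cos θ)))
    with hA
  set B : ℝ → ℝ := fun β => ∫ θ in (0:ℝ)..(2 * Real.pi),
    (β * (1 - Real.cos θ)) * Real.exp (-(β * (1 - Real.cos θ))) with hB
  have tA : Tendsto (fun β => Real.sqrt β * A β) atTop (nhds (Real.sqrt (2 * Real.pi))) := by
    rw [← gauss0]
    refine laplace_aux (fun u => Real.exp (-u)) (by fun_prop) fun u hu => ?_
    rw [abs_of_pos (Real.exp_pos _)]
    have : Real.exp (-u) ≤ Real.exp (-u / 2) := Real.exp_le_exp.2 (by linarith)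
    linarith [Real.exp_pos (-u / 2)]
  have tB : Tendsto (fun β => Real.sqrt β * B β) atTop (nhds (Real.sqrt (2 * Real.pi) / 2)) := by
    rw [← gauss2]
    refine laplace_aux (fun u => u * Real.exp (-u)) (by fun_prop) fun u hu => ?_
    rw [abs_of_nonneg (by positivity)]
    have e : Real.exp (-u) = Real.exp (-u / 2) * Real.exp (-u / 2) := by
      rw [← Real.exp_add]; ring_nf
    have h1 : u / 2 * Real.exp (-u / 2) ≤ 1 := by
      have := Real.add_one_le_exp (u / 2)
      have h2 : Real.exp (u / 2) * Real.exp (-u / 2) = 1 := by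
        rw [← Real.exp_add]; ring_nf; simp
      nlinarith [Real.exp_pos (-u / 2)]
    rw [e]
    nlinarith [Real.exp_pos (-u / 2)]
  have hI0 : ∀ β, besselI 0 β = Real.exp β * A β / (2 * Real.pi) := by
    intro β
    have : (∫ θ in (0:ℝ)..(2 * Real.pi), Real.exp (β * Real.cos θ) * Real.cos (((0:ℤ) : ℝ) * θ))
        = Real.exp β * A β := by
      rw [hA, ← intervalIntegral.integral_const_mul]
      congr 1
      ext θ
      rw [← Real.exp_add]
      simp
      ring
    rw [besselI, this]
    ring
  have hI1 : ∀ β, β * besselI 1 β = Real.exp β * (β * A β - B β) / (2 * Real.pi) := by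
    intro β
    have : β * (∫ θ in (0:ℝ)..(2 * Real.pi),
        Real.exp (β * Real.cos θ) * Real.cos (((1:ℤ) : ℝ) * θ))
        = Real.exp β * (β * A β - B β) := by
      rw [hA, hB]
      simp only
      rw [← intervalIntegral.integral_const_mul, ← intervalIntegral.integral_const_mul,
        ← intervalIntegral.integral_sub (Continuous.intervalIntegrable (by fun_prop) _ _)
          (Continuous.intervalIntegrable (by fun_prop) _ _),
        ← intervalIntegral.integral_const_mul]
      congr 1
      ext θ
      have e : Real.exp (β * Real.cos θ) = Real.exp β * Real.exp (-(β * (1 - Real.cos θ))) := by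
        rw [← Real.exp_add]; ring_nf
      rw [e]
      simp
      ring
    rw [besselI]
    linear_combination (1 / (2 * Real.pi)) * this
  have hsp : 0 < Real.sqrt (2 * Real.pi) := Real.sqrt_pos.2 (by positivity)
  -- ratio
  have tR : Tendsto (fun β => (Real.sqrt β * B β) / (Real.sqrt β * A β)) atTop (nhds (1 / 2)) := by
    have := tB.div tA hsp.ne'
    have e : Real.sqrt (2 * Real.pi) / 2 / Real.sqrt (2 * Real.pi) = 1 / 2 := by field_simp
    rw [e] at this
    exact this
  have tR' : Tendsto (fun β => 2 - (Real.sqrt β * B β) / (Real.sqrt β * A β) / β) atTop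
      (nhds 2) := by
    have := (tR.div_atTop tendsto_id).const_sub 2
    simpa using this
  have tL : Tendsto (fun β => Real.log (Real.sqrt β * A β / (2 * Real.pi))) atTop
      (nhds (Real.log (Real.sqrt (2 * Real.pi) / (2 * Real.pi)))) :=
    (tA.div_const _).log (by positivity)
  have tM := ((tR.mul tR').const_mul (1 / 4)).log (by norm_num)
  have tot := ((tR.neg).sub tL).add (tM.const_mul (1 / 2))
  have hlimit : -(1 - Real.log (Real.pi / 2)) / 2 =
      -(1 / 2) - Real.log (Real.sqrt (2 * Real.pi) / (2 * Real.pi))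
        + 1 / 2 * Real.log (1 / 4 * (1 / 2 * 2)) := by
    rw [Real.log_div hsp.ne' (by positivity), Real.log_sqrt (by positivity),
      Real.log_mul (by norm_num) hpi.ne', Real.log_div hpi.ne' (by norm_num)]
    have : Real.log (1 / 4 * (1 / 2 * 2)) = - (2 * Real.log 2) := by
      rw [show (1 / 4 * (1 / 2 * 2) : ℝ) = (2 ^ 2)⁻¹ by norm_num, Real.log_inv, Real.log_pow]
      norm_num
    rw [this]
    ring
  rw [hlimit]
  refine Tendsto.congr' ?_ tot
  filter_upwards [eventually_gt_atTop 0, tA.eventually (lt_mem_nhds hsp),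
    tR.eventually (lt_mem_nhds (show (0:ℝ) < 1 / 2 by norm_num)),
    tR'.eventually (lt_mem_nhds (show (0:ℝ) < 2 by norm_num))] with β hβ h1 h2 h3
  have hs : 0 < Real.sqrt β := Real.sqrt_pos.2 hβ
  have hApos : 0 < A β := pos_of_mul_pos_right h1 hs.le
  have hR : Real.sqrt β * B β / (Real.sqrt β * A β) = B β / A β := mul_div_mul_left _ _ hs.ne'
  rw [hR] at h2 h3 ⊢
  have hq : qTilde β = (1 - B β / A β / β) / 2 := by
    have e1 : besselI 1 β = Real.exp β * (β * A β - B β) / (2 * Real.pi) / β := by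
      rw [← hI1 β]; field_simp
    have := Real.exp_pos β
    rw [qTilde, e1, hI0]
    field_simp
  rw [hq, hI0]
  generalize B β / A β = R at *
  have e2 : 1 / 4 - ((1 - R / β) / 2) ^ 2 = (1 / 4 * (R * (2 - R / β))) / β := by
    field_simp; ring
  have e3 : Real.exp β * A β / (2 * Real.pi)
      = Real.exp β * (Real.sqrt β * A β / (2 * Real.pi)) / Real.sqrt β := by
    field_simp
  rw [e2, e3, Real.log_div (by positivity) hβ.ne', Real.log_div (by positivity) hs.ne',
    Real.log_mul (Real.exp_pos β).ne' (by positivity), Real.log_exp, Real.log_sqrt hβ.le]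
  field_simp
  ring
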